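/- Let K, T, S be positive integers with S ≤ T and KT > S, let ℓ_1, …, ℓ_T ∈ [0,1]^K with ℓ_0 = (0,…,0), and define η_m = √(S·log(KT/S))/2^{m−1} for m ≥ 1. Let w̃_1 be any element of Δ̃_K, let τ_1 = 0, and suppose the epoch boundaries τ_2 < τ_3 < … and sequences w_t, w̃_{t+1} ∈ Δ̃_K are determined as follows: for each epoch m and each round t with τ_m < t ≤ min(τ_{m+1}, T), w_t is the minimizer over Δ̃_K of w ↦ ⟨w, η_m ℓ_{t−1}⟩ + D_φ(w‖w̃_t) and w̃_{t+1} is the minimizer over Δ̃_K of w ↦ ⟨w, η_m ℓ_t⟩ + D_φ(w‖w̃_t); and τ_{m+1} is the smallest round t with τ_m < t ≤ T such that η_m² · ∑_{s=τ_m+1}^{t} ‖ℓ_s − ℓ_{s−1}‖_∞² > S·log(KT/S) (the last epoch ends at T if no such t exists). Then for every comparator sequence (E_1,…,E_T) ∈ [K]^T with at most S−1 switches, ∑_{t=1}^T ⟨w_t, ℓ_t⟩ − ∑_{t=1}^T ℓ_t[E_t] ≤ 8·√(S·P_∞·log(KT/S)) + 4·√(S·log(KT/S)) + S, where P_∞ =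 ∑_{t=1}^T ‖ℓ_t − ℓ_{t−1}‖_∞². -/

import Mathlib

open Finset

/-- The probability simplex in `ℝ^K`. -/
def stdSimplex' (K : ℕ) : Set (Fin K → ℝ) :=
  {w | (∀ i, 0 ≤ w i) ∧ ∑ i, w i = 1}

/-- The clipped simplex `Δ̃_K = {w ∈ Δ_K : w i ≥ S/(TK)}`. -/
def clippedSimplex (K T S : ℕ) : Set (Fin K → ℝ) :=
  {w | w ∈ stdSimplex' K ∧ ∀ i, (S : ℝ) / (T * K) ≤ w i}

/-- The negative Shannon entropy `φ(w) = ∑ i, w i * log (w i)`. -/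
noncomputable def negEntropy {K : ℕ} (w : Fin K → ℝ) : ℝ :=
  ∑ i, w i * Real.log (w i)

/-- The Bregman divergence with respect to the negative Shannon entropy. -/
noncomputable def breg {K : ℕ} (x y : Fin K → ℝ) : ℝ :=
  negEntropy x - negEntropy y - ∑ i, (x i - y i) * (1 + Real.log (y i))

/-- The standard inner product on `ℝ^K`. -/
def ip {K : ℕ} (x y : Fin K → ℝ) : ℝ := ∑ i, x i * y i

open Filter Topology

lemma ip_smul_right {K : ℕ} (x y : Fin K → ℝ) (c : ℝ) : ip x (c • y) = c * ip x y := by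
  simp only [ip, Pi.smul_apply, smul_eq_mul, Finset.mul_sum]
  exact Finset.sum_congr rfl fun i _ => by ring

lemma breg_eq_sum {K : ℕ} (x y : Fin K → ℝ) :
    breg x y = ∑ i, (x i * Real.log (x i) - x i * Real.log (y i) - x i + y i) := by
  simp only [breg, negEntropy, ← Finset.sum_sub_distrib]
  exact Finset.sum_congr rfl fun i _ => by ring

/-- A scalar Pinsker-type inequality in its linearised form. -/
lemma mul_abs_sub_le_log_div {x y : ℝ} (hx : 0 < x) (hy : 0 < y) (b : ℝ) :
    b * |x - y| ≤
      (x * Real.log x - x * Real.log y - x + y) + b ^ 2 * (x + y) / 2 := by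
  obtain ⟨p, hp, rfl⟩ : ∃ p : ℝ, 0 < p ∧ x = p ^ 2 :=
    ⟨√x, Real.sqrt_pos.2 hx, (Real.sq_sqrt hx.le).symm⟩
  obtain ⟨q, hq, rfl⟩ : ∃ q : ℝ, 0 < q ∧ y = q ^ 2 :=
    ⟨√y, Real.sqrt_pos.2 hy, (Real.sq_sqrt hy.le).symm⟩
  have hlog : p * (Real.log q - Real.log p) ≤ q - p := by
    have h := Real.log_le_sub_one_of_pos (div_pos hq hp)
    rw [Real.log_div hq.ne' hp.ne'] at h
    calc p * (Real.log q - Real.log p) ≤ p * (q / p - 1) := by gcongr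
      _ = q - p := by field_simp
  have hsq : (p - q) ^ 2 ≤ p ^ 2 * Real.log (p ^ 2) - p ^ 2 * Real.log (q ^ 2) - p ^ 2 + q ^ 2 := by
    rw [Real.log_pow, Real.log_pow]
    push_cast
    nlinarith [mul_le_mul_of_nonneg_left hlog hp.le]
  have habs : |p ^ 2 - q ^ 2| = |p - q| * (p + q) := by
    rw [show p ^ 2 - q ^ 2 = (p - q) * (p + q) by ring, abs_mul, abs_of_pos (add_pos hp hq)]
  rw [habs]
  nlinarith [sq_nonneg (|p - q| - b * (p + q) / 2), sq_abs (p - q), sq_nonneg (b * (p - q))]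

lemma breg_nonneg {K : ℕ} {x y : Fin K → ℝ} (hx : ∀ i, 0 < x i) (hy : ∀ i, 0 < y i) :
    0 ≤ breg x y := by
  rw [breg_eq_sum]
  refine Finset.sum_nonneg fun i _ => ?_
  simpa using mul_abs_sub_le_log_div (hx i) (hy i) 0

lemma ip_sub_ip_le_breg {K : ℕ} {x y : Fin K → ℝ} (hx : ∀ i, 0 < x i) (hy : ∀ i, 0 < y i)
    (hxs : ∑ i, x i = 1) (hys : ∑ i, y i = 1) {a : Fin K → ℝ} {b : ℝ} (hab : ∀ i, |a i| ≤ b) :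
    ip y a - ip x a ≤ breg x y + b ^ 2 := by
  calc ip y a - ip x a = ∑ i, (y i - x i) * a i := by
        simp only [ip, ← Finset.sum_sub_distrib, sub_mul]
    _ ≤ ∑ i, ((x i * Real.log (x i) - x i * Real.log (y i) - x i + y i)
          + b ^ 2 * (x i + y i) / 2) := by
        refine Finset.sum_le_sum fun i _ => le_trans ?_ (mul_abs_sub_le_log_div (hx i) (hy i) b)
        calc (y i - x i) * a i ≤ |(y i - x i) * a i| := le_abs_self _
          _ = |a i| * |x i - y i| := by rw [abs_mul, abs_sub_comm, mul_comm]
          _ ≤ b * |x i - y i| := by gcongr; exact hab i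
    _ = breg x y + b ^ 2 := by
        rw [Finset.sum_add_distrib, ← breg_eq_sum, ← Finset.sum_div, ← Finset.mul_sum,
          Finset.sum_add_distrib, hxs, hys]
        ring

lemma breg_three_point {K : ℕ} (v x y : Fin K → ℝ) :
    breg v y = breg v x + breg x y + ∑ i, (v i - x i) * (Real.log (x i) - Real.log (y i)) := by
  simp only [breg_eq_sum, ← Finset.sum_add_distrib]
  exact Finset.sum_congr rfl fun i _ => by ring

/-- The generalised Pythagorean inequality for a mirror-descent step. -/
lemma mirror_step {K : ℕ} {C : Set (Fin K → ℝ)} (hC : Convex ℝ C)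
    (hpos : ∀ z ∈ C, ∀ i, 0 < z i) {x y g : Fin K → ℝ} (hx : x ∈ C)
    (hmin : ∀ v ∈ C, ip x g + breg x y ≤ ip v g + breg v y) {v : Fin K → ℝ} (hv : v ∈ C) :
    ip x g + breg x y + breg v x ≤ ip v g + breg v y := by
  let z : ℝ → Fin K → ℝ := fun s => x + s • (v - x)
  have hz : ∀ s ∈ Set.Ioo (0 : ℝ) 1, z s ∈ C := fun s hs =>
    hC.add_smul_sub_mem hx hv ⟨hs.1.le, hs.2.le⟩
  have hvar : ∀ s ∈ Set.Ioo (0 : ℝ) 1,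
      0 ≤ ∑ i, (v i - x i) * (g i + (Real.log (z s i) - Real.log (y i))) := by
    intro s hs
    have h1 := hmin _ (hz s hs)
    have h2 := breg_three_point x (z s) y
    have h3 := breg_nonneg (hpos _ hx) (hpos _ (hz s hs))
    have h4 : ip (z s) g - ip x g - ∑ i, (x i - z s i) * (Real.log (z s i) - Real.log (y i))
        = s * ∑ i, (v i - x i) * (g i + (Real.log (z s i) - Real.log (y i))) := by
      simp only [ip, ← Finset.sum_sub_distrib, Finset.mul_sum]
      refine Finset.sum_congr rfl fun i _ => ?_
      have : z s i = x i + s * (v i - x i) := rfl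
      generalize Real.log (z s i) = c
      rw [this]; ring
    exact nonneg_of_mul_nonneg_right (h4 ▸ by linarith) hs.1
  have hlim : Tendsto
      (fun s : ℝ => ∑ i, (v i - x i) * (g i + (Real.log (z s i) - Real.log (y i)))) (𝓝[>] 0)
      (𝓝 (∑ i, (v i - x i) * (g i + (Real.log (x i) - Real.log (y i))))) := by
    refine tendsto_nhdsWithin_of_tendsto_nhds (tendsto_finsetSum _ fun i _ => ?_)
    have hzi : Tendsto (fun s : ℝ => z s i) (𝓝 0) (𝓝 (x i)) := by
      have : Continuous fun s : ℝ => x i + s * (v i - x i) := by fun_prop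
      simpa [z] using this.tendsto 0
    exact (((hzi.log (hpos x hx i).ne').sub_const _).const_add _).const_mul _
  have hlast := ge_of_tendsto hlim
    (Filter.eventually_of_mem (Ioo_mem_nhdsGT one_pos) hvar)
  have h5 := breg_three_point v x y
  have h6 : ∑ i, (v i - x i) * (g i + (Real.log (x i) - Real.log (y i)))
      = ip v g - ip x g + ∑ i, (v i - x i) * (Real.log (x i) - Real.log (y i)) := by
    simp only [ip, ← Finset.sum_sub_distrib, ← Finset.sum_add_distrib]
    exact Finset.sum_congr rfl fun i _ => by ring
  linarith

lemma convex_clippedSimplex (K T S : ℕ) : Convex ℝ (clippedSimplex K T S) := by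
  rintro x ⟨⟨hx0, hx1⟩, hx⟩ y ⟨⟨hy0, hy1⟩, hy⟩ a b ha hb hab
  refine ⟨⟨fun i => ?_, ?_⟩, fun i => ?_⟩
  · have := hx0 i
    have := hy0 i
    simp only [Pi.add_apply, Pi.smul_apply, smul_eq_mul]
    positivity
  · simp only [Pi.add_apply, Pi.smul_apply, smul_eq_mul, Finset.sum_add_distrib,
      ← Finset.mul_sum, hx1, hy1, mul_one, hab]
  · simp only [Pi.add_apply, Pi.smul_apply, smul_eq_mul]
    calc (S : ℝ) / (T * K) = a * (S / (T * K)) + b * (S / (T * K)) := by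
          rw [← add_mul, hab, one_mul]
      _ ≤ a * x i + b * y i :=
          add_le_add (mul_le_mul_of_nonneg_left (hx i) ha) (mul_le_mul_of_nonneg_left (hy i) hb)

lemma clippedSimplex_pos {K T S : ℕ} (hK : 0 < K) (hT : 0 < T) (hS : 0 < S) :
    ∀ z ∈ clippedSimplex K T S, ∀ i, 0 < z i := fun _ hz i =>
  lt_of_lt_of_le (by positivity) (hz.2 i)

lemma breg_le_log {K T S : ℕ} (hK : 0 < K) (hT : 0 < T) (hS : 0 < S) {u z : Fin K → ℝ}
    (hu : u ∈ clippedSimplex K T S) (hz : z ∈ clippedSimplex K T S) :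
    breg u z ≤ Real.log (K * T / S) := by
  have hupos := clippedSimplex_pos hK hT hS u hu
  calc breg u z ≤ ∑ i, (u i * Real.log (K * T / S) - u i + z i) := by
        rw [breg_eq_sum]
        refine Finset.sum_le_sum fun i _ => ?_
        have hu1 : u i ≤ 1 := hu.1.2 ▸
          Finset.single_le_sum (fun j _ => hu.1.1 j) (Finset.mem_univ i)
        have hlu : Real.log (u i) ≤ 0 := Real.log_nonpos (hupos i).le hu1
        have hlz : -Real.log (z i) ≤ Real.log (K * T / S) := by
          have h := Real.log_le_log (by positivity) (hz.2 i)
          rw [show (K * T / S : ℝ) = ((S : ℝ) / (T * K))⁻¹ by rw [inv_div, mul_comm], Real.log_inv]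
          linarith
        nlinarith [mul_le_mul_of_nonneg_left hlz (hupos i).le,
          mul_nonpos_of_nonneg_of_nonpos (hupos i).le hlu]
    _ = Real.log (K * T / S) := by
        rw [Finset.sum_add_distrib, Finset.sum_sub_distrib, ← Finset.sum_mul, hu.1.2, hz.1.2]
        ring

/-- The vertex `e` of the simplex, moved into the clipped simplex. -/
noncomputable def clippedVertex (K T S : ℕ) (e : Fin K) : Fin K → ℝ :=
  fun i => (S : ℝ) / (T * K) + if i = e then 1 - (S : ℝ) / T else 0

lemma clippedVertex_mem {K T S : ℕ} (hK : 0 < K) (hT : 0 < T) (hST : S ≤ T) (e : Fin K) :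
    clippedVertex K T S e ∈ clippedSimplex K T S := by
  have hle : (S : ℝ) / T ≤ 1 := by
    rw [div_le_one (by positivity)]; exact_mod_cast hST
  have hge : ∀ i, (S : ℝ) / (T * K) ≤ clippedVertex K T S e i := fun i => by
    simp only [clippedVertex]
    split_ifs <;> linarith
  refine ⟨⟨fun i => le_trans (by positivity) (hge i), ?_⟩, hge⟩
  simp only [clippedVertex, Finset.sum_add_distrib, Finset.sum_ite_eq', Finset.mem_univ, if_true,
    Finset.sum_const, Finset.card_univ, Fintype.card_fin, nsmul_eq_mul]
  field_simp
  ring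

lemma ip_clippedVertex_le {K T S : ℕ} (hK : 0 < K) (hT : 0 < T) (e : Fin K)
    {l : Fin K → ℝ} (hl : ∀ i, l i ∈ Set.Icc (0 : ℝ) 1) :
    ip (clippedVertex K T S e) l ≤ l e + S / T := by
  have hsum : ∑ i, l i ≤ K := by
    simpa using Finset.sum_le_card_nsmul Finset.univ l 1 fun i _ => (hl i).2
  have heq : ip (clippedVertex K T S e) l
      = S / (T * K) * ∑ i, l i + (1 - S / T) * l e := by
    simp only [ip, clippedVertex, add_mul, Finset.sum_add_distrib, ite_mul, zero_mul,
      Finset.sum_ite_eq', Finset.mem_univ, if_true, Finset.mul_sum]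
  have h1 : (S : ℝ) / (T * K) * ∑ i, l i ≤ S / (T * K) * K := by gcongr
  have h2 : (S : ℝ) / (T * K) * K = S / T := by field_simp
  have h3 : 0 ≤ (S : ℝ) / T * l e := mul_nonneg (by positivity) (hl e).1
  rw [heq]
  linarith

/-- A sum telescoping along a piecewise constant index costs at most `G` per piece. -/
lemma sum_switching_telescope {ι : Type*} [DecidableEq ι] (E : ℕ → ι) (f : ι → ℕ → ℝ) {G : ℝ}
    (a n : ℕ) (h0 : ∀ e, ∀ t, a < t → t ≤ a + n + 2 → 0 ≤ f e t)
    (hG : ∀ e, ∀ t, a < t → t ≤ a + n + 1 → f e t ≤ G) :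
    ∑ t ∈ Finset.Ioc a (a + n + 1), (f (E t) t - f (E t) (t + 1))
      ≤ G * (1 + ((Finset.Icc (a + 2) (a + n + 1)).filter fun t => E t ≠ E (t - 1)).card)
        - f (E (a + n + 1)) (a + n + 2) := by
  induction n with
  | zero =>
    have := hG (E (a + 1)) (a + 1) (by omega) (by omega)
    simp only [add_zero, Nat.Ioc_succ_singleton, Finset.sum_singleton]
    rw [Finset.Icc_eq_empty (by omega)]
    simpa using this
  | succ n ih =>
    have ih := ih (fun e t h h' => h0 e t h (by omega)) (fun e t h h' => hG e t h (by omega))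
    have hg := hG (E (a + n + 2)) (a + n + 2) (by omega) (by omega)
    have hn := h0 (E (a + n + 1)) (a + n + 2) (by omega) (by omega)
    rw [show a + (n + 1) + 1 = (a + n + 1) + 1 by ring, Finset.sum_Ioc_succ_top (by omega),
      ← Finset.insert_Icc_right_eq_Icc_add_one (by omega), Finset.filter_insert]
    simp only [Nat.add_sub_cancel]
    split_ifs with hsw
    · rw [Finset.card_insert_of_notMem (by simp)]
      push_cast
      show _ + (f (E (a + n + 2)) (a + n + 2) - f (E (a + n + 2)) (a + n + 3))
        ≤ _ - f (E (a + n + 2)) (a + n + 3)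
      linarith
    · have hsw : E (a + n + 2) = E (a + n + 1) := not_not.1 hsw
      show _ + (f (E (a + n + 2)) (a + n + 2) - f (E (a + n + 2)) (a + n + 3))
        ≤ _ - f (E (a + n + 2)) (a + n + 3)
      rw [hsw]
      linarith

/-- One round of optimistic mirror descent on the clipped simplex. -/
lemma optimistic_step {K T S : ℕ} (hK : 0 < K) (hT : 0 < T) (hS : 0 < S) {η : ℝ} (hη : 0 ≤ η)
    {l l' x y y' u : Fin K → ℝ}
    (hx : x ∈ clippedSimplex K T S) (hy : y ∈ clippedSimplex K T S)
    (hy' : y' ∈ clippedSimplex K T S) (hu : u ∈ clippedSimplex K T S)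
    (hxmin : ∀ v ∈ clippedSimplex K T S,
      ip x (η • l') + breg x y ≤ ip v (η • l') + breg v y)
    (hymin : ∀ v ∈ clippedSimplex K T S,
      ip y' (η • l) + breg y' y ≤ ip v (η • l) + breg v y) :
    η * (ip x l - ip u l) ≤ breg u y - breg u y' + η ^ 2 * ‖l - l'‖ ^ 2 := by
  have hpos := clippedSimplex_pos (K := K) hK hT hS
  have hconv := convex_clippedSimplex K T S
  have h1 := mirror_step hconv hpos hx hxmin hy'
  have h2 := mirror_step hconv hpos hy' hymin hu
  have h3 := breg_nonneg (hpos x hx) (hpos y hy)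
  have h4 := ip_sub_ip_le_breg (a := η • (l - l')) (b := η * ‖l - l'‖) (hpos y' hy') (hpos x hx)
    hy'.1.2 hx.1.2 fun i => by
      rw [Pi.smul_apply, smul_eq_mul, abs_mul, abs_of_nonneg hη]
      gcongr
      exact norm_le_pi_norm (l - l') i
  have hsub : ∀ z : Fin K → ℝ, ip z (l - l') = ip z l - ip z l' := fun z => by
    simp only [ip, ← Finset.sum_sub_distrib, Pi.sub_apply, mul_sub]
  simp only [ip_smul_right, hsub] at h1 h2 h4
  nlinarith

/-- Tracking regret accumulated over an epoch with constant learning rate. -/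
lemma epoch_regret {K T S : ℕ} (hK : 0 < K) (hT : 0 < T) (hS : 0 < S) (hST : S ≤ T)
    (hKTS : S < K * T) {ℓ : ℕ → Fin K → ℝ}
    (hℓ : ∀ t ∈ Finset.Icc 1 T, ∀ i, ℓ t i ∈ Set.Icc (0 : ℝ) 1)
    {η : ℝ} (hη : 0 < η) {a b : ℕ} (hab : a < b) (hbT : b ≤ T) {w wt : ℕ → Fin K → ℝ}
    (hwa : wt (a + 1) ∈ clippedSimplex K T S)
    (hmin : ∀ t, a < t → t ≤ b →
      (w t ∈ clippedSimplex K T S ∧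
        ∀ v ∈ clippedSimplex K T S,
          ip (w t) (η • ℓ (t - 1)) + breg (w t) (wt t)
            ≤ ip v (η • ℓ (t - 1)) + breg v (wt t)) ∧
      (wt (t + 1) ∈ clippedSimplex K T S ∧
        ∀ v ∈ clippedSimplex K T S,
          ip (wt (t + 1)) (η • ℓ t) + breg (wt (t + 1)) (wt t)
            ≤ ip v (η • ℓ t) + breg v (wt t)))
    (E : ℕ → Fin K)
    (hE : ((Finset.Icc 2 T).filter (fun t => E t ≠ E (t - 1))).card ≤ S - 1) :
    ∑ t ∈ Finset.Ioc a b, (ip (w t) (ℓ t) - ℓ t (E t) - S / T)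
      ≤ S * Real.log (K * T / S) / η + η * ∑ t ∈ Finset.Ioc a b, ‖ℓ t - ℓ (t - 1)‖ ^ 2 := by
  have hwt : ∀ t, a < t → t ≤ b + 1 → wt t ∈ clippedSimplex K T S := by
    intro t h1 h2
    rcases Nat.eq_or_lt_of_le h1 with h | h
    · exact h ▸ hwa
    · obtain ⟨s, rfl⟩ : ∃ s, t = s + 1 := ⟨t - 1, by omega⟩
      exact (hmin s (by omega) (by omega)).2.1
  have hlog : 0 ≤ Real.log (K * T / S) := Real.log_nonneg <| by
    rw [le_div_iff₀ (by positivity), one_mul]; exact_mod_cast hKTS.le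
  let U := clippedVertex K T S
  have hU : ∀ e, U e ∈ clippedSimplex K T S := clippedVertex_mem hK hT hST
  have hpos := clippedSimplex_pos (K := K) hK hT hS
  have hround : ∀ t ∈ Finset.Ioc a b, η * (ip (w t) (ℓ t) - ℓ t (E t) - S / T)
      ≤ (breg (U (E t)) (wt t) - breg (U (E t)) (wt (t + 1)))
        + η ^ 2 * ‖ℓ t - ℓ (t - 1)‖ ^ 2 := by
    intro t ht
    rw [Finset.mem_Ioc] at ht
    obtain ⟨⟨hw1, hw2⟩, hw3, hw4⟩ := hmin t ht.1 ht.2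
    refine le_trans ?_ (optimistic_step hK hT hS hη.le hw1 (hwt t ht.1 (by omega)) hw3 (hU (E t))
      hw2 hw4)
    have := ip_clippedVertex_le (S := S) hK hT (E t) (hℓ t (Finset.mem_Icc.2 ⟨by omega, by omega⟩))
    refine mul_le_mul_of_nonneg_left ?_ hη.le
    show _ ≤ _ - ip (clippedVertex K T S (E t)) (ℓ t)
    linarith
  have htel : ∑ t ∈ Finset.Ioc a b, (breg (U (E t)) (wt t) - breg (U (E t)) (wt (t + 1)))
      ≤ S * Real.log (K * T / S) := by
    obtain ⟨n, rfl⟩ : ∃ n, b = a + n + 1 := ⟨b - a - 1, by omega⟩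
    have h := sum_switching_telescope E (fun e t => breg (U e) (wt t)) (G := Real.log (K * T / S))
      a n (fun e t h1 h2 => breg_nonneg (hpos _ (hU e)) (hpos _ (hwt t h1 (by omega))))
      (fun e t h1 h2 => breg_le_log hK hT hS (hU e) (hwt t h1 (by omega)))
    have hlast := breg_nonneg (hpos _ (hU (E (a + n + 1))))
      (hpos _ (hwt (a + n + 2) (by omega) (by omega)))
    have hcard : ((Finset.Icc (a + 2) (a + n + 1)).filter fun t => E t ≠ E (t - 1)).card + 1 ≤ S := by
      have := (Finset.card_le_card (Finset.filter_subset_filter (fun t => E t ≠ E (t - 1))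
        (Finset.Icc_subset_Icc (show 2 ≤ a + 2 by omega) hbT))).trans hE
      omega
    have hcard' : (1 + ((Finset.Icc (a + 2) (a + n + 1)).filter
        fun t => E t ≠ E (t - 1)).card : ℝ) ≤ S := by
      rw [add_comm]; exact_mod_cast hcard
    have := mul_le_mul_of_nonneg_left hcard' hlog
    linarith
  have hsum := Finset.sum_le_sum hround
  rw [← Finset.mul_sum, Finset.sum_add_distrib, ← Finset.mul_sum] at hsum
  rw [← mul_le_mul_iff_right₀ hη]
  calc _ ≤ _ := hsum
    _ ≤ S * Real.log (K * T / S)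
        + η ^ 2 * ∑ t ∈ Finset.Ioc a b, ‖ℓ t - ℓ (t - 1)‖ ^ 2 := by gcongr
    _ = _ := by field_simp

theorem ocs_plus_tracking_regret
    (K T S : ℕ) (hK : 0 < K) (hT : 0 < T) (hS : 0 < S) (hST : S ≤ T) (hKTS : S < K * T)
    (ℓ : ℕ → Fin K → ℝ) (hℓ0 : ℓ 0 = 0)
    (hℓ : ∀ t ∈ Finset.Icc 1 T, ∀ i, ℓ t i ∈ Set.Icc (0 : ℝ) 1)
    (η : ℕ → ℝ)
    (hη : ∀ m, η m = Real.sqrt (S * Real.log (K * T / S)) / 2 ^ (m - 1))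
    (τ : ℕ → ℕ) (hτ1 : τ 1 = 0)
    (w wt : ℕ → Fin K → ℝ)
    (hwt1 : wt 1 ∈ clippedSimplex K T S)
    (hmin : ∀ m, 1 ≤ m → ∀ t, τ m < t → t ≤ τ (m + 1) → t ≤ T →
      (w t ∈ clippedSimplex K T S ∧
        ∀ v ∈ clippedSimplex K T S,
          ip (w t) (η m • ℓ (t - 1)) + breg (w t) (wt t)
            ≤ ip v (η m • ℓ (t - 1)) + breg v (wt t)) ∧
      (wt (t + 1) ∈ clippedSimplex K T S ∧
        ∀ v ∈ clippedSimplex K T S,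
          ip (wt (t + 1)) (η m • ℓ t) + breg (wt (t + 1)) (wt t)
            ≤ ip v (η m • ℓ t) + breg v (wt t)))
    (hepoch : ∀ m, 1 ≤ m → τ m < T →
      τ m < τ (m + 1) ∧ τ (m + 1) ≤ T ∧
      (∀ t, τ m < t → t < τ (m + 1) →
        ¬ (S * Real.log (K * T / S)
            < η m ^ 2 * ∑ s ∈ Finset.Icc (τ m + 1) t, ‖ℓ s - ℓ (s - 1)‖ ^ 2)) ∧
      (S * Real.log (K * T / S)
          < η m ^ 2 * ∑ s ∈ Finset.Icc (τ m + 1) (τ (m + 1)), ‖ℓ s - ℓ (s - 1)‖ ^ 2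
        ∨ τ (m + 1) = T))
    (E : ℕ → Fin K)
    (hE : ((Finset.Icc 2 T).filter (fun t => E t ≠ E (t - 1))).card ≤ S - 1) :
    ∑ t ∈ Finset.Icc 1 T, ip (w t) (ℓ t) - ∑ t ∈ Finset.Icc 1 T, ℓ t (E t)
      ≤ 8 * Real.sqrt (S * (∑ t ∈ Finset.Icc 1 T, ‖ℓ t - ℓ (t - 1)‖ ^ 2)
            * Real.log (K * T / S))
        + 4 * Real.sqrt (S * Real.log (K * T / S)) + S := by
  set L : ℝ := S * Real.log (K * T / S) with hL
  have hLpos : 0 < L := by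
    refine mul_pos (by positivity) (Real.log_pos ?_)
    rw [lt_div_iff₀ (by positivity), one_mul]; exact_mod_cast hKTS
  set R := √L with hR
  have hRpos : 0 < R := Real.sqrt_pos.2 hLpos
  have hRsq : R ^ 2 = L := Real.sq_sqrt hLpos.le
  have hηpos : ∀ m, 0 < η m := fun m => by rw [hη]; positivity
  have hΔ : ∀ t ∈ Finset.Icc 1 T, ‖ℓ t - ℓ (t - 1)‖ ^ 2 ≤ 1 := by
    intro t ht
    refine pow_le_one₀ (norm_nonneg _) ((pi_norm_le_iff_of_nonneg zero_le_one).2 fun i => ?_)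
    have h1 := hℓ t ht i
    have h2 : ℓ (t - 1) i ∈ Set.Icc (0 : ℝ) 1 := by
      rw [Finset.mem_Icc] at ht
      rcases Nat.eq_or_lt_of_le ht.1 with h | h
      · simp [← h, hℓ0]
      · exact hℓ (t - 1) (Finset.mem_Icc.2 ⟨by omega, by omega⟩) i
    rw [Pi.sub_apply, Real.norm_eq_abs, abs_le]
    constructor <;> linarith [h1.1, h1.2, h2.1, h2.2]
  have hIoc : ∀ a b : ℕ, Finset.Icc (a + 1) b = Finset.Ioc a b := fun a b => by
    ext; simp
  have hbudget : ∀ m, 1 ≤ m → τ m < T →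
      η m * ∑ t ∈ Finset.Ioc (τ m) (τ (m + 1)), ‖ℓ t - ℓ (t - 1)‖ ^ 2 ≤ L / η m + η m := by
    intro m hm hmT
    obtain ⟨hlt, hle, hbelow, -⟩ := hepoch m hm hmT
    obtain ⟨c, hc⟩ : ∃ c, τ (m + 1) = c + 1 := ⟨τ (m + 1) - 1, by omega⟩
    have hprev : η m ^ 2 * ∑ t ∈ Finset.Ioc (τ m) c, ‖ℓ t - ℓ (t - 1)‖ ^ 2 ≤ L := by
      rcases Nat.eq_or_lt_of_le (show τ m ≤ c by omega) with h | h
      · simpa [h] using hLpos.le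
      · rw [← hIoc]; exact not_lt.1 (hbelow c h (by omega))
    have hstep := hΔ (c + 1) (Finset.mem_Icc.2 ⟨by omega, by omega⟩)
    have hp := hηpos m
    rw [hc, Finset.sum_Ioc_succ_top (by omega), ← mul_le_mul_iff_right₀ hp]
    have : η m * (L / η m + η m) = L + η m ^ 2 := by field_simp
    rw [this]
    nlinarith [mul_le_mul_of_nonneg_left hstep (sq_nonneg (η m))]
  have hmain : ∀ n, (∀ m, 1 ≤ m → m ≤ n → τ m < T) →
      wt (τ (n + 1) + 1) ∈ clippedSimplex K T S ∧
      ∑ t ∈ Finset.Ioc 0 (τ (n + 1)), (ip (w t) (ℓ t) - ℓ t (E t) - S / T)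
        ≤ R * (2 * 2 ^ n - 2 / 2 ^ n) := by
    intro n
    induction n with
    | zero => intro _; simpa [hτ1] using hwt1
    | succ n ih =>
      intro hn
      obtain ⟨ihw, ihs⟩ := ih fun m h1 h2 => hn m h1 (by omega)
      have hnT := hn (n + 1) (by omega) le_rfl
      obtain ⟨hlt, hle, -, -⟩ := hepoch (n + 1) (by omega) hnT
      have hmin' := fun t h1 h2 => hmin (n + 1) (by omega) t h1 h2 (h2.trans hle)
      refine ⟨(hmin' _ hlt le_rfl).2.1, ?_⟩
      have hreg := epoch_regret hK hT hS hST hKTS hℓ (hηpos (n + 1)) hlt hle ihw hmin' E hE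
      have hbud := hbudget (n + 1) (by omega) hnT
      rw [← hL] at hreg
      have hη' : η (n + 1) = R / 2 ^ n := by rw [hη]; rfl
      have hLη : L / η (n + 1) = R * 2 ^ n := by rw [hη', ← hRsq]; field_simp
      rw [hLη] at hreg hbud
      rw [hη'] at hbud
      rw [← Finset.sum_Ioc_consecutive _ (Nat.zero_le _) hlt.le]
      rw [hη'] at hreg
      have hfin : R * (2 * 2 ^ n - 2 / 2 ^ n) + (R * 2 ^ n + (R * 2 ^ n + R / 2 ^ n))
          = R * (2 * 2 ^ (n + 1) - 2 / 2 ^ (n + 1)) := by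
        field_simp; ring
      rw [← hfin]
      linarith
  have hex : ∃ n, T ≤ τ (n + 1) := by
    by_contra! h
    have : ∀ n, n ≤ τ (n + 1) := by
      intro n
      induction n with
      | zero => omega
      | succ n ih => have := (hepoch (n + 1) (by omega) (h n)).1; omega
    exact absurd (this T) (by have := h T; omega)
  classical
  obtain ⟨n, hn, hbefore⟩ : ∃ n, T ≤ τ (n + 2) ∧ ∀ m, 1 ≤ m → m ≤ n + 1 → τ m < T := by
    have hne : Nat.find hex ≠ 0 := fun h => by
      have := Nat.find_spec hex
      rw [h, hτ1] at this
      omega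
    obtain ⟨n, hn⟩ := Nat.exists_eq_succ_of_ne_zero hne
    refine ⟨n, by simpa [hn] using Nat.find_spec hex, fun m h1 h2 => ?_⟩
    have := Nat.find_min hex (m := m - 1) (by omega)
    rw [Nat.sub_add_cancel h1] at this
    omega
  have hend : τ (n + 2) = T :=
    le_antisymm (hepoch (n + 1) (by omega) (hbefore _ (by omega) le_rfl)).2.1 hn
  have htotal := (hmain (n + 1) hbefore).2
  rw [hend, ← hIoc, zero_add, Finset.sum_sub_distrib, Finset.sum_sub_distrib] at htotal
  have hconst : ∑ _t ∈ Finset.Icc 1 T, (S : ℝ) / T = S := by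
    simp only [Finset.sum_const, Nat.card_Icc, Nat.add_sub_cancel, nsmul_eq_mul]
    field_simp
  rw [hconst] at htotal
  set P := ∑ t ∈ Finset.Icc 1 T, ‖ℓ t - ℓ (t - 1)‖ ^ 2 with hP
  have hPnn : 0 ≤ P := Finset.sum_nonneg fun _ _ => by positivity
  have hsqrt : √(S * P * Real.log (K * T / S)) = R * √P := by
    rw [show (S * P * Real.log (K * T / S) : ℝ) = L * P by rw [hL]; ring,
      Real.sqrt_mul hLpos.le]
  rw [hsqrt]
  have hpow : (2 : ℝ) * 2 ^ (n + 1) ≤ 8 * √P + 4 := by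
    cases n with
    | zero => norm_num
    | succ k =>
      have hk := hbefore (k + 1) (by omega) (by omega)
      have hk' := hbefore (k + 2) (by omega) (by omega)
      obtain ⟨hlt, hle, -, hover⟩ := hepoch (k + 1) (by omega) hk
      have hover := hover.resolve_right (show τ (k + 2) ≠ T by omega)
      have hQP : ∑ s ∈ Finset.Icc (τ (k + 1) + 1) (τ (k + 1 + 1)), ‖ℓ s - ℓ (s - 1)‖ ^ 2 ≤ P :=
        Finset.sum_le_sum_of_subset_of_nonneg (Finset.Icc_subset_Icc (by omega) hle)
          fun _ _ _ => by positivity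
      have hη' : η (k + 1) = R / 2 ^ k := by rw [hη]; rfl
      have h1 : L < (R / 2 ^ k) ^ 2 * P := by
        rw [← hη']; exact hover.trans_le (by gcongr)
      have h2 : ((2 : ℝ) ^ k) ^ 2 ≤ P := by
        rw [div_pow, hRsq, div_mul_eq_mul_div, lt_div_iff₀ (by positivity)] at h1
        exact (lt_of_mul_lt_mul_left h1 hLpos.le).le
      have h3 : (2 : ℝ) ^ k ≤ √P := Real.le_sqrt_of_sq_le h2
      rw [pow_succ, pow_succ]
      linarith
  have hneg : 0 ≤ R * (2 / 2 ^ (n + 1)) := by positivity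
  have := mul_le_mul_of_nonneg_left hpow hRpos.le
  linarith
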